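/- Let n ≥ 1, let P be a symmetric positive definite n×n real matrix, m ∈ ℝⁿ, and let L be an n×n real matrix with L·Lᵀ = P. Then for every polynomial function p : ℝⁿ → ℝ of total degree at most 3, (1/(2n))·Σ_{i=1}^{n} [ p(m + √n·L·e_i) + p(m − √n·L·e_i) ] = ∫_{ℝⁿ} p(x) N(x|m,P) dx, where e_1, …, e_n is the standard basis of ℝⁿ. -/

import Mathlib

open MeasureTheory Matrix Real

/-- The multivariate Gaussian probability density `N(x | m, P)` on `ℝⁿ`. -/
noncomputable def gaussDensity {n : ℕ} (m : Fin n → ℝ) (P : Matrix (Fin n) (Fin n) ℝ)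
    (x : Fin n → ℝ) : ℝ :=
  (2 * π) ^ (-(n : ℝ) / 2) * P.det ^ (-(1 : ℝ) / 2) *
    Real.exp (-(1 / 2) * ((x - m) ⬝ᵥ (P⁻¹ *ᵥ (x - m))))


/-- standard normal density on the line -/
noncomputable def g1 (x : ℝ) : ℝ := ProbabilityTheory.gaussianPDFReal 0 1 x

lemma g1_neg (x : ℝ) : g1 (-x) = g1 x := by
  simp [g1, ProbabilityTheory.gaussianPDFReal]

lemma mom_eq (k : ℕ) :
    ∫ x, x ^ k * g1 x = ∫ x, x ^ k ∂(ProbabilityTheory.gaussianReal 0 1) := by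
  rw [ProbabilityTheory.integral_gaussianReal_eq_integral_smul one_ne_zero]
  simp only [g1, smul_eq_mul, mul_comm]

lemma mom_int (k : ℕ) : Integrable (fun x : ℝ => x ^ k * g1 x) := by
  have h := integrable_rpow_mul_exp_neg_mul_sq (b := 1 / 2) (by norm_num) (s := (k : ℝ))
    (by have : (0 : ℝ) ≤ k := by positivity
        linarith)
  have h2 := h.mul_const (√(2 * π))⁻¹
  refine h2.congr (Filter.Eventually.of_forall fun x => ?_)
  simp only [g1, ProbabilityTheory.gaussianPDFReal, Real.rpow_natCast, NNReal.coe_one, mul_one,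
    sub_zero]
  rw [mul_assoc, mul_comm (rexp _)]
  congr 3
  ring

lemma mom_odd {k : ℕ} (hk : Odd k) : ∫ x, x ^ k * g1 x = 0 := by
  have h := integral_neg_eq_self (fun x : ℝ => x ^ k * g1 x) volume
  simp only [g1_neg, hk.neg_pow, neg_mul, integral_neg] at h
  linarith

lemma mom_zero : ∫ x, x ^ 0 * g1 x = 1 := by
  rw [mom_eq]; simp

lemma mom_two : ∫ x, x ^ 2 * g1 x = 1 := by
  rw [mom_eq]
  have h := ProbabilityTheory.variance_fun_id_gaussianReal (μ := 0) (v := 1)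
  rw [ProbabilityTheory.variance_eq_integral (by fun_prop)] at h
  simpa [ProbabilityTheory.integral_id_gaussianReal] using h

lemma deg_subst {n : ℕ} (f : Fin n → MvPolynomial (Fin n) ℝ) (hf : ∀ i, (f i).totalDegree ≤ 1)
    (q : MvPolynomial (Fin n) ℝ) :
    (MvPolynomial.aeval f q).totalDegree ≤ q.totalDegree := by
  rw [MvPolynomial.aeval_def, MvPolynomial.eval₂_eq']
  refine MvPolynomial.totalDegree_finsetSum_le fun s hs => ?_
  refine (MvPolynomial.totalDegree_mul _ _).trans ?_
  rw [MvPolynomial.algebraMap_eq, MvPolynomial.totalDegree_C, zero_add]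
  refine (MvPolynomial.totalDegree_finsetProd _ _).trans ?_
  refine le_trans ?_ (MvPolynomial.le_totalDegree hs)
  rw [Finsupp.sum_fintype _ _ (fun _ => rfl)]
  refine Finset.sum_le_sum fun i _ => (MvPolynomial.totalDegree_pow _ _).trans ?_
  have := Nat.mul_le_mul_left (s i) (hf i)
  simpa using this

lemma change_var {n : ℕ} (L : Matrix (Fin n) (Fin n) ℝ) (hL : L.det ≠ 0) (m : Fin n → ℝ)
    (F : (Fin n → ℝ) → ℝ) :
    ∫ x, F x = |L.det| * ∫ z, F (m + L *ᵥ z) := by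
  have h1 : ∫ z, F (m + L *ᵥ z) = |L.det|⁻¹ * ∫ x, F (m + x) := by
    have hinj : Function.Injective (Matrix.toLin' L) := by
      intro a b hab
      simp only [Matrix.toLin'_apply] at hab
      exact Matrix.mulVec_injective_of_isUnit
        ((Matrix.isUnit_iff_isUnit_det L).2 (isUnit_iff_ne_zero.2 hL)) hab
    have hcont : Continuous (Matrix.toLin' L) := LinearMap.continuous_of_finiteDimensional _
    have hemb : MeasurableEmbedding (Matrix.toLin' L) := hcont.measurableEmbedding hinj
    have h := hemb.integral_map (μ := volume) (fun x => F (m + x))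
    rw [Real.map_matrix_volume_pi_eq_smul_volume_pi hL, integral_smul_measure] at h
    simp only [Matrix.toLin'_apply] at h
    rw [← h, ENNReal.toReal_ofReal (abs_nonneg _), abs_inv, smul_eq_mul]
  rw [h1, integral_add_left_eq_self F m, ← mul_assoc, mul_inv_cancel₀ (abs_ne_zero.2 hL), one_mul]

lemma dens_eq {n : ℕ} (P L : Matrix (Fin n) (Fin n) ℝ) (hdet : L.det ≠ 0)
    (hL : L * Lᵀ = P) (m z : Fin n → ℝ) :
    |L.det| * gaussDensity m P (m + L *ᵥ z) = ∏ i, g1 (z i) := by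
  have hq : (L *ᵥ z) ⬝ᵥ (P⁻¹ *ᵥ (L *ᵥ z)) = ∑ i, z i ^ 2 := by
    have hu : IsUnit L.det := isUnit_iff_ne_zero.2 hdet
    have hut : IsUnit Lᵀ.det := by rwa [Matrix.det_transpose]
    rw [← hL, Matrix.mul_inv_rev, Matrix.mulVec_mulVec, Matrix.mul_assoc,
      Matrix.nonsing_inv_mul _ hu, Matrix.mul_one, Matrix.dotProduct_mulVec,
      ← Matrix.vecMul_transpose, Matrix.vecMul_vecMul, Matrix.mul_nonsing_inv _ hut,
      Matrix.vecMul_one]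
    simp [dotProduct, sq]
  have hd : P.det ^ (-(1 : ℝ) / 2) = |L.det|⁻¹ := by
    rw [← hL, Matrix.det_mul, Matrix.det_transpose, ← sq, ← sq_abs, neg_div, Real.rpow_neg
      (by positivity), ← Real.sqrt_eq_rpow, Real.sqrt_sq (abs_nonneg _)]
  have hpi : (2 * π) ^ (-(n : ℝ) / 2) = ((√(2 * π))⁻¹) ^ n := by
    rw [neg_div, Real.rpow_neg (by positivity), inv_pow, Real.sqrt_eq_rpow, ← Real.rpow_natCast,
      ← Real.rpow_mul (by positivity)]
    congr 2
    ring
  simp only [gaussDensity, add_sub_cancel_left, hq, hd, hpi, g1,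
    ProbabilityTheory.gaussianPDFReal, NNReal.coe_one, mul_one, sub_zero, Finset.prod_mul_distrib,
    Finset.prod_const, Finset.card_univ, Fintype.card_fin, ← Real.exp_sum]
  have : |L.det| ≠ 0 := abs_ne_zero.2 hdet
  rw [mul_comm (_ ^ n), ← mul_assoc, ← mul_assoc, mul_inv_cancel₀ this, one_mul, Finset.mul_sum]
  congr 2
  exact Finset.sum_congr rfl fun i _ => by ring

lemma mono_int {n : ℕ} (s : Fin n → ℕ) :
    Integrable (fun z : Fin n → ℝ => (∏ i, z i ^ s i) * ∏ i, g1 (z i)) := by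
  simp only [← Finset.prod_mul_distrib]
  exact Integrable.fintype_prod (f := fun i x => x ^ s i * g1 x) (fun i => mom_int (s i))

lemma mono_exact {n : ℕ} (hn : 1 ≤ n) (s : Fin n → ℕ) (hs : ∑ i, s i ≤ 3) :
    (1 / (2 * n) : ℝ) * ∑ j : Fin n,
        ((∏ i, (Real.sqrt n • (Pi.single j 1 : Fin n → ℝ)) i ^ s i) +
          ∏ i, (-(Real.sqrt n • (Pi.single j 1 : Fin n → ℝ))) i ^ s i) =
      ∫ z : Fin n → ℝ, (∏ i, z i ^ s i) * ∏ i, g1 (z i) := by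
  have hn0 : (n : ℝ) ≠ 0 := by positivity
  simp only [← Finset.prod_mul_distrib]
  rw [integral_fintype_prod_volume_eq_prod (fun i x => x ^ s i * g1 x)]
  by_cases h : ∃ i, Odd (s i)
  · obtain ⟨i, hi⟩ := h
    rw [Finset.prod_eq_zero (Finset.mem_univ i) (mom_odd hi)]
    rw [Finset.sum_eq_zero, mul_zero]
    intro j _
    by_cases hk : ∃ k, k ≠ j ∧ s k ≠ 0
    · obtain ⟨k, hkj, hk0⟩ := hk
      rw [Finset.prod_eq_zero (Finset.mem_univ k), Finset.prod_eq_zero (Finset.mem_univ k),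
        add_zero] <;> simp [hkj, hk0]
    · push Not at hk
      have hij : i = j := by
        by_contra hc
        have := hk i hc
        rw [this] at hi
        simp at hi
      subst hij
      rw [Finset.prod_eq_single i (fun k _ hki => by simp [hk k hki]) (by simp),
        Finset.prod_eq_single i (fun k _ hki => by simp [hk k hki]) (by simp)]
      simp only [Pi.neg_apply]
      rw [hi.neg_pow]
      ring
  · push Not at h
    by_cases h0 : ∀ i, s i = 0
    · simp only [h0, mom_zero]
      simp
      field_simp
      norm_num
    · push Not at h0
      obtain ⟨i, hi⟩ := h0
      have hle : s i + ∑ k ∈ Finset.univ.erase i, s k ≤ 3 := by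
        rwa [Finset.add_sum_erase _ _ (Finset.mem_univ i)]
      have hev : Even (s i) := Nat.not_odd_iff_even.1 (h i)
      have h2 : s i = 2 := by obtain ⟨a, ha⟩ := hev; omega
      have hk : ∀ k, k ≠ i → s k = 0 := by
        intro k hki
        have := Finset.single_le_sum (f := s) (fun _ _ => Nat.zero_le _)
          (Finset.mem_erase.2 ⟨hki, Finset.mem_univ k⟩)
        have hev : Even (s k) := Nat.not_odd_iff_even.1 (h k)
        obtain ⟨a, ha⟩ := hev; omega
      rw [Finset.prod_eq_single i (fun k _ hki => by rw [hk k hki, mom_zero]) (by simp), h2,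
        mom_two]
      have hp : ∀ y : Fin n → ℝ, ∏ k, y k ^ s k = y i ^ 2 := fun y => by
        rw [Finset.prod_eq_single i (fun k _ hki => by simp [hk k hki]) (by simp), h2]
      simp only [hp]
      rw [Finset.sum_eq_single i (fun j _ hj => by simp [hj.symm]) (by simp)]
      simp
      field_simp
      norm_num

lemma std_exact {n : ℕ} (hn : 1 ≤ n) (r : MvPolynomial (Fin n) ℝ) (hr : r.totalDegree ≤ 3) :
    (1 / (2 * n) : ℝ) * ∑ j : Fin n,
        (MvPolynomial.eval (Real.sqrt n • (Pi.single j 1 : Fin n → ℝ)) r +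
          MvPolynomial.eval (-(Real.sqrt n • (Pi.single j 1 : Fin n → ℝ))) r) =
      ∫ z : Fin n → ℝ, MvPolynomial.eval z r * ∏ i, g1 (z i) := by
  simp only [MvPolynomial.eval_eq', Finset.sum_mul, mul_assoc]
  rw [integral_finsetSum r.support (fun s _ => (mono_int (fun i => s i)).const_mul (r.coeff s))]
  simp only [integral_const_mul]
  simp only [← Finset.sum_add_distrib, ← mul_add]
  rw [Finset.sum_comm, Finset.mul_sum]
  refine Finset.sum_congr rfl fun s hs => ?_
  rw [← mono_exact hn s, ← Finset.mul_sum]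
  · ring
  · have := MvPolynomial.le_totalDegree hs
    rw [Finsupp.sum_fintype _ _ (fun _ => rfl)] at this
    exact this.trans hr

/-- Exactness of the spherical cubature sigma-point rule (2n points `m ± √n·L·eᵢ`, equal
weights `1/(2n)`, with `L·Lᵀ = P`) for all polynomials of total degree at most 3. -/
theorem stmt_12 {n : ℕ} (hn : 1 ≤ n)
    (P L : Matrix (Fin n) (Fin n) ℝ) (hPsymm : P.IsSymm) (hPpd : P.PosDef)
    (hL : L * Lᵀ = P) (m : Fin n → ℝ)
    (q : MvPolynomial (Fin n) ℝ) (hq : q.totalDegree ≤ 3) :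
    (1 / (2 * n) : ℝ) * ∑ i : Fin n,
        (MvPolynomial.eval (m + Real.sqrt n • (L *ᵥ Pi.single i 1)) q +
          MvPolynomial.eval (m - Real.sqrt n • (L *ᵥ Pi.single i 1)) q) =
      ∫ x : Fin n → ℝ, MvPolynomial.eval x q * gaussDensity m P x := by

  have hdet : L.det ≠ 0 := by
    intro h0
    have := hPpd.det_pos
    rw [← hL, Matrix.det_mul, h0, zero_mul] at this
    exact lt_irrefl _ this
  set f : Fin n → MvPolynomial (Fin n) ℝ := fun i =>
    MvPolynomial.C (m i) + ∑ j, MvPolynomial.C (L i j) * MvPolynomial.X j with hfdef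
  have hf : ∀ i, (f i).totalDegree ≤ 1 := by
    intro i
    refine (MvPolynomial.totalDegree_add _ _).trans (max_le (by simp) ?_)
    refine MvPolynomial.totalDegree_finsetSum_le fun j _ => ?_
    refine (MvPolynomial.totalDegree_mul _ _).trans ?_
    simp
  have hev : ∀ z, MvPolynomial.eval z (MvPolynomial.aeval f q) =
      MvPolynomial.eval (m + L *ᵥ z) q := by
    intro z
    rw [MvPolynomial.aeval_def, MvPolynomial.algebraMap_eq, MvPolynomial.eval_eval₂]
    simp only [MvPolynomial.eval, MvPolynomial.coe_eval₂Hom]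
    congr 1
    · ext x; simp
    · ext i
      simp [hfdef, Matrix.mulVec, dotProduct]
  rw [change_var L hdet m, ← integral_const_mul]
  have key := std_exact hn _ ((deg_subst f hf q).trans hq)
  simp only [hev] at key
  have hint : ∀ z : Fin n → ℝ, |L.det| * (MvPolynomial.eval (m + L *ᵥ z) q *
      gaussDensity m P (m + L *ᵥ z)) =
      MvPolynomial.eval (m + L *ᵥ z) q * ∏ i, g1 (z i) := fun z => by
    rw [mul_left_comm, dens_eq P L hdet hL]
  simp only [hint]
  rw [← key]
  simp only [Matrix.mulVec_neg, Matrix.mulVec_smul, sub_eq_add_neg]
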